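/- arXiv:2605.10693 — 4 statements merged into one kernel-verified Lean document; each statement's English description precedes it below -/
import Mathlib

section
/- Let M and N be von Neumann algebras on a complex Hilbert space H with N ⊆ M', let p ∈ M be an orthogonal projection with central support 1 in M, and let q ∈ N be an orthogonal projection with central support 1 in N. Then N = M' if and only if {(pq) m (pq) : m ∈ M} = {T ∈ B(H) : T = (pq)T(pq) and T((pq) n (pq)) = ((pq) n (pq)) T for all n ∈ N} (i.e., identifying operators T with T = (pq)T(pq) with operators on pqH, the condition says pMpq = (qNpq)' on pqH). -/
namespace ContinuousLinearMap

variable {H : Type*} [NormedAddCommGroup H] [InnerProductSpace ℂ H] [CompleteSpace H]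

/-- Two families of operators with the same Gram matrix are related by a bounded operator that
vanishes on the orthogonal complement of the joint range of the first family. -/
theorem exists_mul_eq_of_star_mul_eq {ι : Type*} (a b : ι → H →L[ℂ] H)
    (h : ∀ i j, star (a i) * a j = star (b i) * b j) :
    ∃ V : H →L[ℂ] H, (∀ i, V * a i = b i) ∧ ∀ x, (∀ i, star (a i) x = 0) → V x = 0 := by
  classical
  let Φ : (ι → H →L[ℂ] H) → (ι →₀ H) →ₗ[ℂ] H := fun c =>
    Finsupp.lsum ℂ fun i => (c i : H →ₗ[ℂ] H)
  have hΦ : ∀ c f, Φ c f = f.sum fun i x => c i x := fun c f => by simp [Φ]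
  have hinner : ∀ c f, inner ℂ (Φ c f) (Φ c f) =
      f.sum fun i x => f.sum fun j y => inner ℂ x ((star (c i) * c j) y) := fun c f => by
    rw [hΦ, Finsupp.sum_inner]
    refine Finsupp.sum_congr fun i _ => ?_
    rw [Finsupp.inner_sum]
    refine Finsupp.sum_congr fun j _ => ?_
    change _ = inner ℂ (f i) (adjoint (c i) (c j (f j)))
    rw [adjoint_inner_right]
  have hnorm : ∀ f, ‖Φ b f‖ = ‖Φ a f‖ := fun f => by
    rw [norm_eq_sqrt_re_inner (𝕜 := ℂ), norm_eq_sqrt_re_inner (𝕜 := ℂ), hinner, hinner]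
    simp_rw [h]
  let K : Submodule ℂ H := (Φ a).range.topologicalClosure
  have : CompleteSpace K := (Submodule.isClosed_topologicalClosure _).completeSpace_coe
  let e : (ι →₀ H) →ₗ[ℂ] K :=
    (Φ a).codRestrict K fun f => Submodule.le_topologicalClosure _ (LinearMap.mem_range_self _ f)
  have he : DenseRange e := by
    rw [DenseRange, Subtype.dense_iff]
    intro x hx
    have : ((↑) : K → H) '' Set.range e = ((Φ a).range : Set H) := by
      rw [← Set.range_comp]; rfl
    change x ∈ closure (((↑) : K → H) '' Set.range e)
    rw [this]
    exact hx
  refine ⟨(Φ b).extendOfNorm e ∘L K.orthogonalProjectionOnto, fun i => ?_, fun x hx => ?_⟩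
  · ext x
    have hs : ∀ c, Φ c (Finsupp.single i x) = c i x := fun c => by simp [Φ]
    have hx : ((e (Finsupp.single i x) : K) : H) = a i x := hs a
    change (Φ b).extendOfNorm e (K.orthogonalProjectionOnto (a i x)) = b i x
    rw [← hx,
      Submodule.orthogonalProjectionOnto_mem_subspace_eq_self,
      LinearMap.extendOfNorm_eq he ⟨1, fun f => ?_⟩, hs]
    rw [one_mul, hnorm]
    rfl
  · have : x ∈ Kᗮ := by
      rw [Submodule.orthogonal_closure, Submodule.mem_orthogonal]
      rintro _ ⟨f, rfl⟩
      rw [hΦ, Finsupp.sum_inner]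
      refine Finset.sum_eq_zero fun i _ => ?_
      change inner ℂ (a i (f i)) x = 0
      rw [← adjoint_inner_right, ← star_eq_adjoint, hx, inner_zero_right]
    rw [comp_apply, Submodule.orthogonalProjectionOnto_apply_of_mem_orthogonal this, map_zero]

/-- An operator vanishing on the joint range of a family and on its orthogonal complement is zero. -/
theorem eq_zero_of_mul_eq_zero_of_apply_eq_zero {ι : Type*} (a : ι → H →L[ℂ] H)
    (X : H →L[ℂ] H) (h : ∀ i, X * a i = 0) (h' : ∀ x, (∀ i, star (a i) x = 0) → X x = 0) :
    X = 0 := by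
  have hker : X.kerᗮ = ⊥ := by
    rw [Submodule.eq_bot_iff]
    intro x hx
    have hxk : x ∈ X.ker := h' x fun i => by
      refine ext_inner_left ℂ fun y => ?_
      rw [star_eq_adjoint, adjoint_inner_right, inner_zero_right]
      exact hx _ (congr($(h i) y))
    exact inner_self_eq_zero.1 (hx x hxk)
  have : X.ker = ⊤ := by
    have : CompleteSpace X.ker := X.isClosed_ker.completeSpace_coe
    rwa [Submodule.orthogonal_eq_bot_iff] at hker
  ext x
  exact (this ▸ Submodule.mem_top : x ∈ X.ker)

end ContinuousLinearMap

namespace VonNeumannAlgebra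

open ContinuousLinearMap

variable {H : Type*} [NormedAddCommGroup H] [InnerProductSpace ℂ H] [CompleteSpace H]

/-- If `p` has central support `1` in `M`, then the joint range of `M p` is dense, so that an
operator annihilating it is zero. -/
theorem eq_zero_of_mul_mul_eq_zero (M : VonNeumannAlgebra H) {p : H →L[ℂ] H}
    (hpM : p ∈ M)
    (hp_central : ∀ z ∈ M, z ∈ M.commutant → IsSelfAdjoint z → z * z = z → z * p = p → z = 1)
    {X : H →L[ℂ] H} (hX : ∀ A ∈ M, X * A * p = 0) : X = 0 := by
  let L : Submodule ℂ H := Submodule.span ℂ {x | ∃ A ∈ M, ∃ y, A (p y) = x}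
  let K := L.topologicalClosure
  have : CompleteSpace K := (Submodule.isClosed_topologicalClosure _).completeSpace_coe
  have hmem : ∀ A ∈ M, ∀ y, A (p y) ∈ K := fun A hA y =>
    L.le_topologicalClosure (Submodule.subset_span ⟨A, hA, y, rfl⟩)
  have hle : ∀ K' : Submodule ℂ H, IsClosed (K' : Set H) → (∀ A ∈ M, ∀ y, A (p y) ∈ K') →
      K ≤ K' := fun K' hc h => by
    refine Submodule.topologicalClosure_minimal _ (Submodule.span_le.2 ?_) hc
    rintro _ ⟨A, hA, y, rfl⟩
    exact h A hA y
  have hK : IsClosed (K : Set H) := Submodule.isClosed_topologicalClosure _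
  have hP : IsStarProjection K.starProjection := isStarProjection_starProjection
  have h1 : K.starProjection = 1 := by
    refine hp_central _ ?_ ?_ hP.isSelfAdjoint hP.isIdempotentElem ?_
    · refine (IsStarProjection.mem_iff hP M).2 fun y hy => ?_
      rw [Submodule.range_starProjection]
      refine hle (K.comap (y : H →ₗ[ℂ] H)) (hK.preimage y.continuous) fun A hA x => ?_
      have h : (A * p) * y = y * (A * p) := mem_commutant_iff.1 hy _ (mul_mem hA hpM)
      have h2 : y (A (p x)) = A (p (y x)) := congr($h.symm x)
      simpa [h2] using hmem A hA (y x)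
    · refine (IsStarProjection.mem_iff hP M.commutant).2 fun y hy => ?_
      rw [commutant_commutant] at hy
      rw [Submodule.range_starProjection]
      exact hle (K.comap (y : H →ₗ[ℂ] H)) (hK.preimage y.continuous) fun A hA x =>
        hmem (y * A) (mul_mem hy hA) x
    · ext x
      exact Submodule.starProjection_eq_self_iff.2 (hmem 1 (one_mem M) x)
  ext x
  refine hle X.ker X.isClosed_ker (fun A hA y => congr($(hX A hA) y)) ?_
  rw [← Submodule.starProjection_eq_self_iff, h1]
  rfl

/-- A unitary commuting with a projection `e` and with `e n e` for `n ∈ N` agrees on the range of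
`e` with an element of the commutant of `N`. -/
theorem exists_mem_commutant_of_unitary (N : VonNeumannAlgebra H) {e U : H →L[ℂ] H}
    (he : IsStarProjection e) (hU : star U * U = 1)
    (hUN : ∀ n ∈ N, U * (e * n * e) = e * n * e * U) :
    ∃ m ∈ N.commutant, m * e = U * e := by
  have hee : e * e = e := he.isIdempotentElem
  have hes : star e = e := he.isSelfAdjoint
  have hUe : U * e = e * U := by simpa [hee] using hUN 1 (one_mem N)
  obtain ⟨V, hV, hV'⟩ := exists_mul_eq_of_star_mul_eq (fun n : N => (n : H →L[ℂ] H) * e)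
    (fun n : N => (n : H →L[ℂ] H) * (U * e)) fun m n => by
      have h := hUN _ (mul_mem (star_mem m.2) n.2)
      calc star ((m : H →L[ℂ] H) * e) * (n * e) = star U * U * (e * (star m.1 * n) * e) := by
            rw [hU, star_mul, hes]; noncomm_ring
        _ = star U * (e * (star m.1 * n) * e * U) := by rw [mul_assoc, h]
        _ = star (m.1 * (U * e)) * (n.1 * (U * e)) := by
            rw [hUe]; simp only [star_mul, hes, mul_assoc]
  refine ⟨V, mem_commutant_iff.2 fun n hn => ?_, ?_⟩
  · rw [← sub_eq_zero]
    refine eq_zero_of_mul_eq_zero_of_apply_eq_zero (fun k : N => (k : H →L[ℂ] H) * e) _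
      (fun k => ?_) fun x hx => ?_
    · have h1 : V * (n * k.1 * e) = n * k.1 * (U * e) := hV ⟨n * k, mul_mem hn k.2⟩
      have h2 : V * (k.1 * e) = k.1 * (U * e) := hV k
      calc (n * V - V * n) * (k.1 * e) = n * (V * (k.1 * e)) - V * (n * k.1 * e) := by noncomm_ring
        _ = 0 := by rw [h1, h2]; noncomm_ring
    · have h1 : V (n x) = 0 := hV' _ fun k => by
        have h2 : star (star n * k.1 * e) x = 0 := hx ⟨star n * k, mul_mem (star_mem hn) k.2⟩
        simpa [star_mul, mul_assoc] using h2
      simp [h1, hV' x hx]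
  · simpa using hV 1

/-- An operator `T = e T e` commuting with `e N e` is the compression of an element of the
commutant of `N`. -/
theorem exists_mem_commutant_compression_eq (N : VonNeumannAlgebra H) {e T : H →L[ℂ] H}
    (he : IsStarProjection e) (hT : T = e * T * e)
    (hTN : ∀ n ∈ N, T * (e * n * e) = e * n * e * T) :
    ∃ m ∈ N.commutant, T = e * m * e := by
  let A : StarSubalgebra ℂ (H →L[ℂ] H) :=
    StarSubalgebra.centralizer ℂ {x | ∃ n ∈ N, x = e * n * e}
  have hA : ∀ S, S ∈ A → ∀ n ∈ N, S * (e * n * e) = e * n * e * S := fun S hS n hn =>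
    ((StarSubalgebra.mem_centralizer_iff ℂ).1 hS _ ⟨n, hn, rfl⟩).1.symm
  have hTA : T ∈ A := by
    rw [StarSubalgebra.mem_centralizer_iff]
    rintro _ ⟨n, hn, rfl⟩
    refine ⟨(hTN n hn).symm, ?_⟩
    have h : star (e * n * e) = e * star n * e := by
      simp [star_mul, he.isSelfAdjoint.star_eq, mul_assoc]
    rw [h, hTN _ (star_mem hn)]
  have hclosed : IsClosed (A : Set (H →L[ℂ] H)) := by
    rw [StarSubalgebra.coe_centralizer]
    exact Set.isClosed_centralizer _
  have key : ∀ S : A, ∃ m ∈ N.commutant, m * e = S.1 * e := fun S => by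
    have hS : S ∈ Submodule.span ℂ (unitary A : Set A) := by
      rw [CStarAlgebra.span_unitary]; trivial
    induction hS using Submodule.span_induction with
    | mem U hU =>
      exact N.exists_mem_commutant_of_unitary he (congr(($(hU.1) : A).1)) (hA U U.2)
    | zero => exact ⟨0, zero_mem _, by simp⟩
    | add S S' _ _ ih ih' =>
      obtain ⟨m, hm, h⟩ := ih
      obtain ⟨m', hm', h'⟩ := ih'
      exact ⟨m + m', add_mem hm hm', by simp [add_mul, h, h']⟩
    | smul c S _ ih =>
      obtain ⟨m, hm, h⟩ := ih
      exact ⟨c • m, N.commutant.toStarSubalgebra.smul_mem hm c, by simp [h]⟩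
  obtain ⟨m, hm, h⟩ := key ⟨T, hTA⟩
  refine ⟨m, hm, ?_⟩
  rw [mul_assoc, h, ← mul_assoc]
  exact hT

/-- If `p ∈ M` has central support `1` in `M` and `p (B T A) p ∈ M` for all `A, B ∈ M`, then
`T ∈ M`. -/
theorem mem_of_compression_mem (M : VonNeumannAlgebra H) {p : H →L[ℂ] H}
    (hpM : p ∈ M) (hp : IsSelfAdjoint p)
    (hp_central : ∀ z ∈ M, z ∈ M.commutant → IsSelfAdjoint z → z * z = z → z * p = p → z = 1)
    {T : H →L[ℂ] H} (h : ∀ A ∈ M, ∀ B ∈ M, p * (B * T * A) * p ∈ M) : T ∈ M := by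
  rw [← M.commutant_commutant, mem_commutant_iff]
  intro S hS
  have hS' := mem_commutant_iff.1 hS
  rw [← sub_eq_zero]
  refine M.eq_zero_of_mul_mul_eq_zero hpM hp_central fun A hA => ?_
  rw [← star_eq_zero]
  refine M.eq_zero_of_mul_mul_eq_zero hpM hp_central fun B hB => ?_
  rw [← star_eq_zero]
  have h1 := hS' _ (h A hA _ (star_mem hB))
  have h2 := hS' _ (mul_mem hpM (star_mem hB))
  have h3 := hS' _ (mul_mem hA hpM)
  calc star (star ((S * T - T * S) * A * p) * B * p)
      = (p * star B * S) * T * (A * p) - (p * star B) * T * (S * (A * p)) := by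
        simp only [star_mul, star_star, hp.star_eq]; noncomm_ring
    _ = S * (p * (star B * T * A) * p) - (p * (star B * T * A) * p) * S := by
        rw [h2, ← h3]; noncomm_ring
    _ = 0 := by rw [h1, sub_self]

end VonNeumannAlgebra


/-- Let `M` and `N` be von Neumann algebras on a complex Hilbert space `H`
with `N ⊆ M'`, let `p ∈ M` be an orthogonal projection with central support `1` in `M`, and
let `q ∈ N` be an orthogonal projection with central support `1` in `N`.  Then `N = M'` iff
`{(pq) m (pq) : m ∈ M} = {T ∈ B(H) : T = (pq) T (pq) and T commutes with (pq) n (pq) for all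
n ∈ N}`; identifying operators `T` with `T = (pq) T (pq)` with operators on `pqH`, the
condition says `p M p q = (q N p q)'` on `p q H`. -/
theorem commutant_iff_doubly_compressed_commutant
    {H : Type*} [NormedAddCommGroup H] [InnerProductSpace ℂ H] [CompleteSpace H]
    (M N : VonNeumannAlgebra H)
    (hNM : (N : Set (H →L[ℂ] H)) ⊆ Set.centralizer (M : Set (H →L[ℂ] H)))
    (p : H →L[ℂ] H) (hpM : p ∈ M) (hp_sa : IsSelfAdjoint p) (hp_idem : p * p = p)
    (hp_central : ∀ z : H →L[ℂ] H, z ∈ M →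
      z ∈ Set.centralizer (M : Set (H →L[ℂ] H)) →
      IsSelfAdjoint z → z * z = z → z * p = p → z = 1)
    (q : H →L[ℂ] H) (hqN : q ∈ N) (hq_sa : IsSelfAdjoint q) (hq_idem : q * q = q)
    (hq_central : ∀ z : H →L[ℂ] H, z ∈ N →
      z ∈ Set.centralizer (N : Set (H →L[ℂ] H)) →
      IsSelfAdjoint z → z * z = z → z * q = q → z = 1) :
    (N : Set (H →L[ℂ] H)) = Set.centralizer (M : Set (H →L[ℂ] H)) ↔
      {T : H →L[ℂ] H | ∃ m ∈ M, T = (p * q) * m * (p * q)} =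
        {T : H →L[ℂ] H | T = (p * q) * T * (p * q) ∧
          ∀ n ∈ N, T * ((p * q) * n * (p * q)) = ((p * q) * n * (p * q)) * T} := by
  have hM : ∀ m ∈ M, m ∈ N.commutant := fun m hm =>
    VonNeumannAlgebra.mem_commutant_iff.2 fun n hn => (hNM hn m hm).symm
  have hp_central' : ∀ z ∈ M, z ∈ M.commutant → IsSelfAdjoint z → z * z = z → z * p = p →
      z = 1 := fun z hz hz' =>
    hp_central z hz (by rwa [← SetLike.mem_coe, VonNeumannAlgebra.coe_commutant] at hz')
  have hq_central' : ∀ z ∈ N, z ∈ N.commutant → IsSelfAdjoint z → z * z = z → z * q = q →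
      z = 1 := fun z hz hz' =>
    hq_central z hz (by rwa [← SetLike.mem_coe, VonNeumannAlgebra.coe_commutant] at hz')
  have hpq : p * q = q * p := hNM hqN p hpM
  have he : IsStarProjection (p * q) :=
    IsStarProjection.mul ⟨hp_idem, hp_sa⟩ ⟨hq_idem, hq_sa⟩ hpq
  have hee : p * q * (p * q) = p * q := he.isIdempotentElem
  have hcorner : ∀ T ∈ N.commutant, p * T * p ∈ N.commutant := fun T hT =>
    mul_mem (mul_mem (hM p hpM) hT) (hM p hpM)
  have hcompr : ∀ T ∈ N.commutant, p * q * T * (p * q) = p * T * p * q := fun T hT => by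
    have h := VonNeumannAlgebra.mem_commutant_iff.1 (hcorner T hT) q hqN
    calc p * q * T * (p * q) = q * (p * T * p) * q := by rw [hpq]; nth_rw 2 [← hpq]; noncomm_ring
      _ = p * T * p * q := by rw [h, mul_assoc, hq_idem]
  have hself : ∀ T, p * q * T * (p * q) = p * q * (p * q * T * (p * q)) * (p * q) := fun T => by
    calc p * q * T * (p * q) = (p * q * (p * q)) * T * (p * q * (p * q)) := by rw [hee]
      _ = _ := by noncomm_ring
  have hcomm : ∀ T ∈ N.commutant, ∀ n ∈ N,
      (p * q * T * (p * q)) * ((p * q) * n * (p * q)) =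
        ((p * q) * n * (p * q)) * (p * q * T * (p * q)) := fun T hT n hn => by
    have hQ : q * n * q ∈ N := mul_mem (mul_mem hqN hn) hqN
    have h1 := VonNeumannAlgebra.mem_commutant_iff.1 (hcorner T hT) _ hQ
    have h2 := VonNeumannAlgebra.mem_commutant_iff.1 (hM p hpM) _ hQ
    have hn' : p * q * n * (p * q) = q * n * q * p := by
      calc p * q * n * (p * q) = p * (q * n * q * p) := by rw [hpq]; nth_rw 1 [← hpq]; noncomm_ring
        _ = q * n * q * p := by rw [h2, ← mul_assoc, hp_idem]
    rw [hcompr T hT, hn']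
    calc p * T * p * q * (q * n * q * p) = p * T * p * ((q * q) * n * q) * p := by noncomm_ring
      _ = q * n * q * (p * T * (p * p)) := by rw [hq_idem, ← h1]; noncomm_ring
      _ = p * T * p * (q * n * (q * q)) := by rw [hp_idem, hq_idem, h1]
      _ = q * n * q * (p * T * p) * q := by rw [h1]; noncomm_ring
      _ = q * n * q * ((p * p) * T * p) * q := by rw [hp_idem]
      _ = q * n * q * p * (p * T * p * q) := by noncomm_ring
  constructor
  · intro h
    have hNM' : N.commutant = M := by
      have : N = M.commutant := SetLike.coe_injective (by rw [h, M.coe_commutant])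
      rw [this, M.commutant_commutant]
    ext T
    constructor
    · rintro ⟨m, hm, rfl⟩
      exact ⟨hself m, hcomm m (hM m hm)⟩
    · rintro ⟨hT, hTN⟩
      obtain ⟨m, hm, h⟩ := N.exists_mem_commutant_compression_eq he hT hTN
      exact ⟨m, hNM' ▸ hm, h⟩
  · intro h
    have hpTp : ∀ T ∈ N.commutant, p * T * p ∈ M := fun T hT => by
      obtain ⟨m, hm, hTm⟩ : p * q * T * (p * q) ∈
          {T : H →L[ℂ] H | ∃ m ∈ M, T = (p * q) * m * (p * q)} := by
        rw [h]
        exact ⟨hself T, hcomm T hT⟩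
      rw [hcompr T hT, hcompr m (hM m hm)] at hTm
      have hX : p * T * p - p * m * p = 0 :=
        N.eq_zero_of_mul_mul_eq_zero hqN hq_central' fun A hA => by
          have hXA := VonNeumannAlgebra.mem_commutant_iff.1
            (sub_mem (hcorner T hT) (hcorner m (hM m hm))) A hA
          rw [← hXA, mul_assoc, sub_mul, hTm, sub_self, mul_zero]
      rw [sub_eq_zero.1 hX]
      exact mul_mem (mul_mem hpM hm) hpM
    have hNM' : N.commutant ≤ M := fun T hT =>
      M.mem_of_compression_mem hpM hp_sa hp_central' fun A hA B hB =>
        hpTp _ (mul_mem (mul_mem (hM B hB) hT) (hM A hA))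
    refine hNM.antisymm fun S hS => ?_
    rw [← N.centralizer_centralizer, ← N.coe_commutant]
    exact fun T hT => hS T (hNM' hT)
end

section
/- Let M be a von Neumann algebra on a complex Hilbert space H, Ω ∈ H, and p ∈ M an orthogonal projection such that: pΩ = Ω; p has central support 1 in M; and Ω is separating for the corner pMp, i.e., every y ∈ M with y = pyp and yΩ = 0 is zero. Then the action of M on the closure of MΩ is faithful: if x ∈ M satisfies x(mΩ) = 0 for all m ∈ M, then x = 0. -/
/-- The vectors killed by `x * b` for every `b ∈ M`: the largest `M`-invariant subspace of
`ker x` when `M` is a von Neumann algebra. -/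
def VonNeumannAlgebra.invariantKer
    {H : Type*} [NormedAddCommGroup H] [InnerProductSpace ℂ H] [CompleteSpace H]
    (M : VonNeumannAlgebra H) (x : H →L[ℂ] H) : Submodule ℂ H :=
  ⨅ b : M, (x * (b : H →L[ℂ] H)).ker

namespace VonNeumannAlgebra

variable {H : Type*} [NormedAddCommGroup H] [InnerProductSpace ℂ H] [CompleteSpace H]
  {M : VonNeumannAlgebra H} {x : H →L[ℂ] H}

theorem mem_invariantKer {ξ : H} : ξ ∈ M.invariantKer x ↔ ∀ b ∈ M, x (b ξ) = 0 := by
  simp [invariantKer]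

theorem isClosed_invariantKer : IsClosed (M.invariantKer x : Set H) := by
  rw [invariantKer, Submodule.coe_iInf]
  exact isClosed_iInter fun b => (x * (b : H →L[ℂ] H)).isClosed_ker

instance : CompleteSpace (M.invariantKer x) :=
  isClosed_invariantKer.completeSpace_coe

theorem starProjection_invariantKer_mem_commutant :
    (M.invariantKer x).starProjection ∈ M.commutant := by
  rw [IsStarProjection.mem_iff isStarProjection_starProjection, commutant_commutant]
  intro y hy
  rw [Submodule.range_starProjection]
  exact fun ξ hξ => mem_invariantKer.2 fun b hb => mem_invariantKer.1 hξ (b * y) (mul_mem hb hy)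

theorem starProjection_invariantKer_mem (hx : x ∈ M) :
    (M.invariantKer x).starProjection ∈ M := by
  rw [IsStarProjection.mem_iff isStarProjection_starProjection]
  intro y hy
  rw [Submodule.range_starProjection]
  refine fun ξ hξ => mem_invariantKer.2 fun b hb => ?_
  have hcomm := DFunLike.congr_fun (mem_commutant_iff.1 hy (x * b) (mul_mem hx hb)) ξ
  simpa [mem_invariantKer.1 hξ b hb] using hcomm

/-- An element of `M` that is killed by right multiplication by `M p` vanishes when `p` has
central support `1`. -/
theorem eq_zero_of_forall_mul_mul_eq_zero {p : H →L[ℂ] H}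
    (hp_central : ∀ z : H →L[ℂ] H, z ∈ M →
      z ∈ Set.centralizer (M : Set (H →L[ℂ] H)) →
      IsSelfAdjoint z → z * z = z → z * p = p → z = 1)
    (hx : x ∈ M) (h : ∀ b ∈ M, x * b * p = 0) : x = 0 := by
  have hz : (M.invariantKer x).starProjection = 1 := by
    refine hp_central _ (starProjection_invariantKer_mem hx) ?_
      isStarProjection_starProjection.isSelfAdjoint
      isStarProjection_starProjection.isIdempotentElem ?_
    · rw [← coe_commutant]
      exact starProjection_invariantKer_mem_commutant
    · ext ξ
      refine Submodule.starProjection_eq_self_iff.2 (mem_invariantKer.2 fun b hb => ?_)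
      exact DFunLike.congr_fun (h b hb) ξ
  ext ξ
  have hξ : ξ ∈ M.invariantKer x :=
    Submodule.starProjection_eq_self_iff.1 (DFunLike.congr_fun hz ξ)
  exact mem_invariantKer.1 hξ 1 (one_mem M)

end VonNeumannAlgebra


/-- Let `M` be a von Neumann algebra on a complex Hilbert space `H`, `Ω ∈ H`,
and `p ∈ M` an orthogonal projection such that `p Ω = Ω`, `p` has central support `1` in `M`
(the only orthogonal projection `z ∈ M ∩ M'` with `z * p = p` is `z = 1`), and `Ω` is separating
for the corner `p M p` (every `y ∈ M` with `y = p y p` and `y Ω = 0` is zero).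
Then the action of `M` on the closure of `M Ω` is faithful: if `x ∈ M` kills `m Ω` for every
`m ∈ M`, then `x = 0`. -/
theorem faithful_action_on_cyclic_subspace
    {H : Type*} [NormedAddCommGroup H] [InnerProductSpace ℂ H] [CompleteSpace H]
    (M : VonNeumannAlgebra H) (Ω : H)
    (p : H →L[ℂ] H) (hpM : p ∈ M) (hp_sa : IsSelfAdjoint p) (hp_idem : p * p = p)
    (hpΩ : p Ω = Ω)
    (hp_central : ∀ z : H →L[ℂ] H, z ∈ M →
      z ∈ Set.centralizer (M : Set (H →L[ℂ] H)) →
      IsSelfAdjoint z → z * z = z → z * p = p → z = 1)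
    (h_sep : ∀ y : H →L[ℂ] H, y ∈ M → y = p * y * p → y Ω = 0 → y = 0) :
    ∀ x : H →L[ℂ] H, x ∈ M → (∀ m ∈ M, x (m Ω) = 0) → x = 0 := by
  intro x hx hxΩ
  refine VonNeumannAlgebra.eq_zero_of_forall_mul_mul_eq_zero hp_central hx fun b hb => ?_
  have hadj : star (x * b * p) = p * star (x * b) := by rw [star_mul, hp_sa.star_eq]
  rw [← CStarRing.star_mul_self_eq_zero_iff]
  refine h_sep _ ?_ ?_ ?_
  · exact mul_mem (star_mem (mul_mem (mul_mem hx hb) hpM)) (mul_mem (mul_mem hx hb) hpM)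
  · rw [hadj]
    simp only [mul_assoc, hp_idem]
    simp only [← mul_assoc, hp_idem]
  · simp [hpΩ, hxΩ b hb]
end

section
/- Fix s > 0. Let (𝔄, p) be a net of algebras over ℤ² with a net of projections and let ψ be a canonical state for (𝔄, p). Let R and S be finite subsets of ℤ² such that there exist finite subsets R̂ and Ŝ of ℤ² with R ≪_s R̂, R̂ ∩ S = ∅, R̂ ⊆ Ŝ, and S ≪_s Ŝ. Then ψ(xy) = ψ(x)·ψ(y) for all x ∈ 𝔄(R) and y ∈ 𝔄(S). -/
/-- `R ≪ₛ S` for finite subsets of `ℤ²`: for every `ℓ ∈ R` the closed `ℓ∞`-ball of radius `s`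
centred at `ℓ` (for the sup metric on `ℤ × ℤ`) is contained in `S`. -/
def CompletelySurrounded (s : ℝ) (R S : Finset (ℤ × ℤ)) : Prop :=
  ∀ ℓ ∈ R, ∀ z : ℤ × ℤ, dist z ℓ ≤ s → z ∈ S

/-- Fix `s > 0`.  Let `(𝔄, p)` be a net of algebras over `ℤ²` with a net of
projections, and let `ψ` be a canonical state for `(𝔄, p)`: a state with `ψ (p R) = 1` for
every finite `R` and `p S * x * p S = ψ x • p S` whenever `R ≪ₛ S` and `x ∈ 𝔄(R)`.
If `R, S` are finite subsets of `ℤ²` for which there exist finite `R̂, Ŝ` with `R ≪ₛ R̂`,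
`R̂ ∩ S = ∅`, `R̂ ⊆ Ŝ` and `S ≪ₛ Ŝ`, then `ψ (x * y) = ψ x * ψ y` for all `x ∈ 𝔄(R)` and
`y ∈ 𝔄(S)`. -/
theorem canonical_state_product_on_separated_regions
    (s : ℝ) (hs : 0 < s)
    {𝔄 : Type*} [NormedRing 𝔄] [StarRing 𝔄] [CStarRing 𝔄]
    [NormedAlgebra ℂ 𝔄] [StarModule ℂ 𝔄] [CompleteSpace 𝔄]
    (A : Finset (ℤ × ℤ) → StarSubalgebra ℂ 𝔄)
    (hA_closed : ∀ R, IsClosed (A R : Set 𝔄))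
    (hA_iso : ∀ R S : Finset (ℤ × ℤ), R ⊆ S → A R ≤ A S)
    (hA_loc : ∀ R S : Finset (ℤ × ℤ), Disjoint R S →
      ∀ x ∈ A R, ∀ y ∈ A S, x * y = y * x)
    (p : Finset (ℤ × ℤ) → 𝔄)
    (hp_mem : ∀ R, p R ∈ A R)
    (hp_sa : ∀ R, IsSelfAdjoint (p R))
    (hp_idem : ∀ R, p R * p R = p R)
    (hp_mono : ∀ R S : Finset (ℤ × ℤ), R ⊆ S → p S * p R = p S ∧ p R * p S = p S)
    (ψ : 𝔄 →ₗ[ℂ] ℂ)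
    (hψ_one : ψ 1 = 1)
    (hψ_pos : ∀ x : 𝔄, ∃ t : ℝ, 0 ≤ t ∧ ψ (star x * x) = (t : ℂ))
    (hψ_proj : ∀ R, ψ (p R) = 1)
    (hψ_canon : ∀ R S : Finset (ℤ × ℤ), CompletelySurrounded s R S →
      ∀ x ∈ A R, p S * x * p S = ψ x • p S)
    (R S : Finset (ℤ × ℤ))
    (hsep : ∃ Rh Sh : Finset (ℤ × ℤ), CompletelySurrounded s R Rh ∧ Disjoint Rh S ∧
      Rh ⊆ Sh ∧ CompletelySurrounded s S Sh) :
    ∀ x ∈ A R, ∀ y ∈ A S, ψ (x * y) = ψ x * ψ y := by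
  obtain ⟨Rh, Sh, hR, hdisj, hsub, hS⟩ := hsep
  intro x hx y hy
  have hunion : CompletelySurrounded s (R ∪ S) Sh := by
    intro ℓ hℓ z hz
    rcases Finset.mem_union.mp hℓ with h | h
    · exact hsub (hR ℓ h z hz)
    · exact hS ℓ h z hz
  have hxy := hψ_canon (R ∪ S) Sh hunion (x * y)
    (mul_mem (hA_iso R _ Finset.subset_union_left hx) (hA_iso S _ Finset.subset_union_right hy))
  obtain ⟨hleft, hright⟩ := hp_mono Rh Sh hsub
  have hcomm : p Rh * y = y * p Rh := hA_loc Rh S hdisj _ (hp_mem Rh) y hy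
  have hfactor : p Sh * (x * y) * p Sh = (ψ x * ψ y) • p Sh := by
    calc p Sh * (x * y) * p Sh
        = (p Sh * p Rh) * (x * y) * (p Rh * p Sh) := by rw [hleft, hright]
      _ = p Sh * p Rh * x * (y * p Rh) * p Sh := by simp only [mul_assoc]
      _ = p Sh * (p Rh * x * p Rh) * y * p Sh := by rw [← hcomm]; simp only [mul_assoc]
      _ = ψ x • (p Sh * p Rh * y * p Sh) := by
        rw [hψ_canon R Rh hR x hx]; simp only [mul_smul_comm, smul_mul_assoc]
      _ = (ψ x * ψ y) • p Sh := by rw [hleft, hψ_canon S Sh hS y hy, smul_smul]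
  simpa [hψ_proj] using congrArg ψ (hxy.symm.trans hfactor)
end

section
/- Fix s > 0. Let (𝔄, p) be a net of algebras over ℤ² with a net of projections and let ψ be a canonical state for (𝔄, p). Let θ : ℤ² → ℤ² be an involutive bijection that is an isometry for the ℓ∞ metric, and let Θ : 𝔄 → 𝔄 be a continuous conjugate-linear *-automorphism of period 2 (an additive bijection with Θ(λx) = conj(λ)Θ(x), Θ(xy) = Θ(x)Θ(y), Θ(x*) = Θ(x)*, Θ∘Θ = id) such that Θ(𝔄(R)) = 𝔄(θR) and Θ(p_R) = p_{θR} for every finite R ⊆ ℤ². Then for every finite R ⊆ ℤ² and every x ∈ 𝔄(R): ψ(Θ(x)) = conj(ψ(x)); in particular ψ(Θ(x)* Θ(x)) = ψ(x* x). -/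
theorem exists_completelySurrounded (s : ℝ) (R : Finset (ℤ × ℤ)) :
    ∃ S : Finset (ℤ × ℤ), CompletelySurrounded s R S := by
  have hfin : (⋃ ℓ ∈ R, Metric.closedBall ℓ s).Finite :=
    R.finite_toSet.biUnion fun ℓ _ => (isCompact_closedBall ℓ s).finite_of_discrete
  refine ⟨hfin.toFinset, fun ℓ hℓ z hz => ?_⟩
  rw [Set.Finite.mem_toFinset]
  exact Set.mem_biUnion hℓ (Metric.mem_closedBall.mpr hz)

theorem CompletelySurrounded.image {s : ℝ} {R S : Finset (ℤ × ℤ)}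
    (h : CompletelySurrounded s R S) {θ : ℤ × ℤ → ℤ × ℤ} (hθ : Function.Surjective θ)
    (hθ_isom : ∀ a b : ℤ × ℤ, dist (θ a) (θ b) = dist a b) :
    CompletelySurrounded s (R.image θ) (S.image θ) := by
  intro ℓ hℓ z hz
  obtain ⟨m, hm, rfl⟩ := Finset.mem_image.mp hℓ
  obtain ⟨w, rfl⟩ := hθ z
  rw [hθ_isom] at hz
  exact Finset.mem_image_of_mem θ (h m hm w hz)

/-- Fix `s > 0`.  Let `(𝔄, p)` be a net of algebras over `ℤ²` with a net of
projections and `ψ` a canonical state for `(𝔄, p)`.  Let `θ : ℤ² → ℤ²` be an involutive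
bijection which is an isometry for the `ℓ∞` metric, and let `Θ : 𝔄 → 𝔄` be a continuous
conjugate-linear *-automorphism of period 2 such that `Θ(𝔄(R)) = 𝔄(θ R)` and
`Θ(p_R) = p_{θ R}` for every finite `R`.  Then for every finite `R` and every `x ∈ 𝔄(R)`:
`ψ (Θ x) = conj (ψ x)`; in particular `ψ ((Θ x)* (Θ x)) = ψ (x* x)`. -/
theorem canonical_state_reflection_antiunitary
    (s : ℝ) (hs : 0 < s)
    {𝔄 : Type*} [NormedRing 𝔄] [StarRing 𝔄] [CStarRing 𝔄]
    [NormedAlgebra ℂ 𝔄] [StarModule ℂ 𝔄] [CompleteSpace 𝔄]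
    (A : Finset (ℤ × ℤ) → StarSubalgebra ℂ 𝔄)
    (hA_closed : ∀ R, IsClosed (A R : Set 𝔄))
    (hA_iso : ∀ R S : Finset (ℤ × ℤ), R ⊆ S → A R ≤ A S)
    (hA_loc : ∀ R S : Finset (ℤ × ℤ), Disjoint R S →
      ∀ x ∈ A R, ∀ y ∈ A S, x * y = y * x)
    (p : Finset (ℤ × ℤ) → 𝔄)
    (hp_mem : ∀ R, p R ∈ A R)
    (hp_sa : ∀ R, IsSelfAdjoint (p R))
    (hp_idem : ∀ R, p R * p R = p R)
    (hp_mono : ∀ R S : Finset (ℤ × ℤ), R ⊆ S → p S * p R = p S ∧ p R * p S = p S)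
    (ψ : 𝔄 →ₗ[ℂ] ℂ)
    (hψ_one : ψ 1 = 1)
    (hψ_pos : ∀ x : 𝔄, ∃ t : ℝ, 0 ≤ t ∧ ψ (star x * x) = (t : ℂ))
    (hψ_proj : ∀ R, ψ (p R) = 1)
    (hψ_canon : ∀ R S : Finset (ℤ × ℤ), CompletelySurrounded s R S →
      ∀ x ∈ A R, p S * x * p S = ψ x • p S)
    (θ : ℤ × ℤ → ℤ × ℤ)
    (hθ_inv : Function.Involutive θ)
    (hθ_isom : ∀ a b : ℤ × ℤ, dist (θ a) (θ b) = dist a b)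
    (Θ : 𝔄 → 𝔄)
    (hΘ_cont : Continuous Θ)
    (hΘ_add : ∀ x y : 𝔄, Θ (x + y) = Θ x + Θ y)
    (hΘ_smul : ∀ (c : ℂ) (x : 𝔄), Θ (c • x) = (starRingEnd ℂ c) • Θ x)
    (hΘ_mul : ∀ x y : 𝔄, Θ (x * y) = Θ x * Θ y)
    (hΘ_star : ∀ x : 𝔄, Θ (star x) = star (Θ x))
    (hΘ_inv : Function.Involutive Θ)
    (hΘ_alg : ∀ R : Finset (ℤ × ℤ), Θ '' (A R : Set 𝔄) = (A (R.image θ) : Set 𝔄))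
    (hΘ_proj : ∀ R : Finset (ℤ × ℤ), Θ (p R) = p (R.image θ)) :
    ∀ R : Finset (ℤ × ℤ), ∀ x ∈ A R,
      ψ (Θ x) = starRingEnd ℂ (ψ x) ∧ ψ (star (Θ x) * Θ x) = ψ (star x * x) := by
  have key : ∀ R : Finset (ℤ × ℤ), ∀ x ∈ A R, ψ (Θ x) = starRingEnd ℂ (ψ x) := by
    intro R x hx
    obtain ⟨S, hS⟩ := exists_completelySurrounded s R
    have hΘx : Θ x ∈ A (R.image θ) := by
      rw [← SetLike.mem_coe, ← hΘ_alg]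
      exact Set.mem_image_of_mem Θ hx
    have h₁ := hψ_canon _ _ (hS.image hθ_inv.surjective hθ_isom) _ hΘx
    have h₂ := congrArg Θ (hψ_canon R S hS x hx)
    rw [hΘ_mul, hΘ_mul, hΘ_smul, hΘ_proj, h₁] at h₂
    simpa [hψ_proj] using congrArg ψ h₂
  intro R x hx
  refine ⟨key R x hx, ?_⟩
  obtain ⟨t, -, ht⟩ := hψ_pos x
  rw [← hΘ_star, ← hΘ_mul, key R _ (mul_mem (star_mem hx) hx), ht, Complex.conj_ofReal]
end
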